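/- Let ρ(r) = r + √(1 + r²). There exists a function C : (0,∞) × [1,∞) → (0,∞), monotonically increasing in its first argument, such that the following holds: for every a < b, every integer m ≥ 3, every choice of m+1 distinct nodes in [a,b] whose Lagrange interpolation operator 𝓘_m^{[a,b]} : C([a,b]) → 𝒫_m satisfies the stability bound ‖𝓘_m^{[a,b]} f‖_{C([a,b])} ≤ Λ_m ‖f‖_{C([a,b])} for all f ∈ C([a,b]) with some Λ_m ≥ 1, every δ ≥ 1, every C_G, A > 0, and every f of Gevrey class G^δ([a,b], C_G, A), one has, with B = A(b−a)/2, the bound sup_{x ∈ [a,b]} |f(x) − (𝓘_m^{[a,b]} f)(x)| ≤ C(B,δ) · C_G · (Λ_m + 1) · ρ(1/B)^{−m^{1/δ}/e²}. -/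

import Mathlib

/-- `ρ(r) = r + √(1 + r²)`. -/
noncomputable def rho (r : ℝ) : ℝ := r + Real.sqrt (1 + r ^ 2)

/-- `f : ℝ → ℝ` is of Gevrey class `G^δ([a,b], C_G, A)`: it is `C^∞` on a
neighborhood of `[a,b]` and satisfies `|f⁽ⁿ⁾(x)| ≤ C_G·Aⁿ·(n!)^δ` on `[a,b]`. -/
def GevreyOn (a b δ CG A : ℝ) (f : ℝ → ℝ) : Prop :=
  (∃ U : Set ℝ, IsOpen U ∧ Set.Icc a b ⊆ U ∧ ContDiffOn ℝ (⊤ : ℕ∞) f U) ∧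
    ∀ n : ℕ, ∀ x ∈ Set.Icc a b,
      |iteratedDeriv n f x| ≤ CG * A ^ n * (n.factorial : ℝ) ^ δ

/-- The Lagrange interpolation polynomial of `f` at the `m+1` nodes. -/
noncomputable def lagInterp {m : ℕ} (nodes : Fin (m + 1) → ℝ) (f : ℝ → ℝ) :
    Polynomial ℝ :=
  Lagrange.interpolate Finset.univ nodes (fun j => f (nodes j))

/-- The squared modulus of the trigonometric polynomial `∑ aⱼ e^{ijt}`, `j < N`. -/
noncomputable def squareKernel (a : ℕ → ℝ) (N : ℕ) (t : ℝ) : ℝ :=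
  (∑ j ∈ Finset.range N, a j * Real.cos (j * t)) ^ 2 +
    (∑ j ∈ Finset.range N, a j * Real.sin (j * t)) ^ 2

lemma squareKernel_nonneg (a : ℕ → ℝ) (N : ℕ) (t : ℝ) : 0 ≤ squareKernel a N t := by
  unfold squareKernel; positivity

lemma continuous_squareKernel (a : ℕ → ℝ) (N : ℕ) : Continuous (squareKernel a N) := by
  unfold squareKernel; fun_prop

lemma squareKernel_eq_sum (a : ℕ → ℝ) (N : ℕ) (t : ℝ) :
    squareKernel a N t = ∑ j ∈ Finset.range N, ∑ k ∈ Finset.range N,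
      a j * a k * Real.cos ((j - k : ℤ) * t) := by
  unfold squareKernel
  rw [sq, sq, Finset.sum_mul_sum, Finset.sum_mul_sum, ← Finset.sum_add_distrib]
  refine Finset.sum_congr rfl fun j _ => ?_
  rw [← Finset.sum_add_distrib]
  refine Finset.sum_congr rfl fun k _ => ?_
  push_cast
  rw [sub_mul, Real.cos_sub]
  ring

lemma integral_cos_int_mul_sub (l : ℤ) (θ : ℝ) :
    ∫ φ in -Real.pi..Real.pi, Real.cos (l * (θ - φ)) = if l = 0 then 2 * Real.pi else 0 := by
  split_ifs with h
  · subst h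
    simp
    ring
  · have hl : (l : ℝ) ≠ 0 := by exact_mod_cast h
    have h1 : ∀ φ ∈ Set.uIcc (-Real.pi) Real.pi, HasDerivAt
        (fun φ : ℝ => -(Real.sin (l * (θ - φ)) / l)) (Real.cos (l * (θ - φ))) φ := by
      intro φ _
      have h := (((hasDerivAt_id φ).const_sub θ).const_mul (l : ℝ)).sin.div_const (l : ℝ)
      refine h.neg.congr_deriv ?_
      rw [mul_neg_one, mul_neg, neg_div, neg_neg, mul_div_cancel_right₀ _ hl, id]
    rw [intervalIntegral.integral_eq_sub_of_hasDerivAt h1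
      (Continuous.intervalIntegrable (by fun_prop) _ _)]
    have h2 : Real.sin (l * (θ - -Real.pi)) = Real.sin (l * (θ - Real.pi)) := by
      rw [show l * (θ - -Real.pi) = l * (θ - Real.pi) + l * (2 * Real.pi) by ring]
      exact Real.sin_add_int_mul_two_pi _ _
    rw [h2]; ring

lemma integral_squareKernel (a : ℕ → ℝ) (N : ℕ) (θ : ℝ) :
    ∫ φ in -Real.pi..Real.pi, squareKernel a N (θ - φ) =
      2 * Real.pi * ∑ j ∈ Finset.range N, a j ^ 2 := by
  simp_rw [squareKernel_eq_sum]
  rw [intervalIntegral.integral_finsetSum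
    (fun _ _ => Continuous.intervalIntegrable (by fun_prop) _ _), Finset.mul_sum]
  refine Finset.sum_congr rfl fun j hj => ?_
  rw [intervalIntegral.integral_finsetSum
    (fun _ _ => Continuous.intervalIntegrable (by fun_prop) _ _)]
  simp_rw [intervalIntegral.integral_const_mul, integral_cos_int_mul_sub, sub_eq_zero,
    Nat.cast_inj, mul_ite, mul_zero]
  rw [Finset.sum_ite_eq, if_pos hj]
  ring

lemma integral_cos_mul_squareKernel (a : ℕ → ℝ) (N : ℕ) (c θ : ℝ) (h0 : a 0 = 0) (hN : a N = 0)
    (ha : ∀ j, a j + a (j + 2) = 2 * c * a (j + 1)) :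
    ∫ φ in -Real.pi..Real.pi, Real.cos (θ - φ) * squareKernel a N (θ - φ) =
      c * (2 * Real.pi * ∑ j ∈ Finset.range N, a j ^ 2) := by
  have key : ∀ φ, Real.cos (θ - φ) * squareKernel a N (θ - φ) =
      ∑ j ∈ Finset.range N, ∑ k ∈ Finset.range N, a j * a k / 2 *
        (Real.cos ((j - k + 1 : ℤ) * (θ - φ)) + Real.cos ((j - k - 1 : ℤ) * (θ - φ))) := by
    intro φ
    rw [squareKernel_eq_sum, Finset.mul_sum]
    refine Finset.sum_congr rfl fun j _ => ?_
    rw [Finset.mul_sum]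
    refine Finset.sum_congr rfl fun k _ => ?_
    push_cast
    rw [add_mul _ (1 : ℝ), sub_mul ((j : ℝ) - k) (1 : ℝ), one_mul, Real.cos_add,
      Real.cos_sub (((j : ℝ) - k) * (θ - φ))]
    ring
  simp_rw [key]
  rw [intervalIntegral.integral_finsetSum
    (fun _ _ => Continuous.intervalIntegrable (by fun_prop) _ _), Finset.mul_sum, Finset.mul_sum]
  refine Finset.sum_congr rfl fun j hj => ?_
  rw [intervalIntegral.integral_finsetSum
    (fun _ _ => Continuous.intervalIntegrable (by fun_prop) _ _)]
  have h1 : ∀ k : ℕ, ((j : ℤ) - k + 1 = 0) ↔ j + 1 = k := fun k => by omega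
  have h2 : ∀ k : ℕ, ((j : ℤ) - k - 1 = 0) ↔ j = k + 1 := fun k => by omega
  have h3 : ∀ k : ℕ, ∫ φ in -Real.pi..Real.pi, a j * a k / 2 *
        (Real.cos ((j - k + 1 : ℤ) * (θ - φ)) + Real.cos ((j - k - 1 : ℤ) * (θ - φ))) =
      Real.pi * a j * ((if j + 1 = k then a k else 0) + if j = k + 1 then a k else 0) := by
    intro k
    rw [intervalIntegral.integral_const_mul, intervalIntegral.integral_add
      (Continuous.intervalIntegrable (by fun_prop) _ _)
      (Continuous.intervalIntegrable (by fun_prop) _ _), integral_cos_int_mul_sub,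
      integral_cos_int_mul_sub]
    simp only [h1, h2]
    split_ifs <;> ring
  simp_rw [h3]
  rw [← Finset.mul_sum, Finset.sum_add_distrib, Finset.sum_ite_eq]
  have h4 : (if j + 1 ∈ Finset.range N then a (j + 1) else 0) = a (j + 1) := by
    split_ifs with h
    · rfl
    · have : j + 1 = N := by simp at h hj; omega
      rw [this, hN]
  rw [h4]
  rcases j with _ | j
  · simp [h0]
  · have h5 : ∑ k ∈ Finset.range N, (if j + 1 = k + 1 then a k else 0) = a j := by
      simp only [Nat.add_right_cancel_iff, Finset.sum_ite_eq]
      rw [if_pos (by simp at hj ⊢; omega)]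
    rw [h5, add_comm (a (j + 1 + 1)), ha j]
    ring

open Polynomial in
/-- Convolving a continuous even function with a square kernel gives a polynomial in `cos θ`. -/
lemma exists_polynomial_integral_squareKernel (a : ℕ → ℝ) (m : ℕ) (g : ℝ → ℝ)
    (hg : Continuous g) (heven : ∀ φ, g (-φ) = g φ) :
    ∃ p : ℝ[X], p.natDegree ≤ m ∧ ∀ θ, p.eval (Real.cos θ) =
      ∫ φ in -Real.pi..Real.pi, g φ * squareKernel a (m + 1) (θ - φ) := by
  have hodd : ∀ l : ℤ, ∫ φ in -Real.pi..Real.pi, g φ * Real.sin (l * φ) = 0 := by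
    intro l
    have h := intervalIntegral.integral_comp_neg (a := -Real.pi) (b := Real.pi)
      (fun φ => g φ * Real.sin (l * φ))
    simp only [heven, mul_neg, Real.sin_neg, intervalIntegral.integral_neg, neg_neg] at h
    linarith
  refine ⟨∑ j ∈ Finset.range (m + 1), ∑ k ∈ Finset.range (m + 1),
    C (a j * a k * ∫ φ in -Real.pi..Real.pi, g φ * Real.cos ((j - k : ℤ) * φ)) *
      Chebyshev.T ℝ (j - k : ℤ), ?_, fun θ => ?_⟩
  · refine natDegree_sum_le_of_forall_le _ _ fun j hj =>
      natDegree_sum_le_of_forall_le _ _ fun k hk => (natDegree_C_mul_le _ _).trans ?_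
    rw [Chebyshev.natDegree_T]
    simp at hj hk
    omega
  · simp_rw [squareKernel_eq_sum, Finset.mul_sum]
    rw [intervalIntegral.integral_finsetSum
      (fun _ _ => Continuous.intervalIntegrable (by fun_prop) _ _), eval_finsetSum]
    refine Finset.sum_congr rfl fun j _ => ?_
    rw [intervalIntegral.integral_finsetSum
      (fun _ _ => Continuous.intervalIntegrable (by fun_prop) _ _), eval_finsetSum]
    refine Finset.sum_congr rfl fun k _ => ?_
    rw [eval_mul, eval_C, Chebyshev.T_real_cos]
    have : ∀ φ, g φ * (a j * a k * Real.cos ((j - k : ℤ) * (θ - φ))) =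
        a j * a k * Real.cos ((j - k : ℤ) * θ) * (g φ * Real.cos ((j - k : ℤ) * φ)) +
        a j * a k * Real.sin ((j - k : ℤ) * θ) *
          (g φ * Real.sin ((j - k : ℤ) * φ)) := by
      intro φ
      rw [mul_sub, Real.cos_sub]
      ring
    simp_rw [this]
    rw [intervalIntegral.integral_add (Continuous.intervalIntegrable (by fun_prop) _ _)
      (Continuous.intervalIntegrable (by fun_prop) _ _), intervalIntegral.integral_const_mul,
      intervalIntegral.integral_const_mul, hodd]
    ring

open Polynomial in
/-- Jackson's inequality on `[-1, 1]`. -/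
lemma exists_polynomial_near_of_lipschitz_unit (m : ℕ) (hm : 1 ≤ m) (L : ℝ) (hL : 0 ≤ L)
    (g : ℝ → ℝ)
    (hg : ∀ x ∈ Set.Icc (-1 : ℝ) 1, ∀ y ∈ Set.Icc (-1 : ℝ) 1, |g x - g y| ≤ L * |x - y|) :
    ∃ p : ℝ[X], p.natDegree ≤ m ∧
      ∀ x ∈ Set.Icc (-1 : ℝ) 1, |g x - p.eval x| ≤ L * (Real.pi / m) := by
  obtain ⟨α, hα⟩ : ∃ α : ℝ, α = Real.pi / (m + 1) := ⟨_, rfl⟩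
  have hm0 : (1 : ℝ) ≤ m := by exact_mod_cast hm
  have hα0 : 0 < α := hα ▸ by positivity
  obtain ⟨a, ha⟩ : ∃ a : ℕ → ℝ, ∀ j, a j = Real.sin (j * α) := ⟨_, fun _ => rfl⟩
  obtain ⟨S, hS⟩ : ∃ S : ℝ, S = 2 * Real.pi * ∑ j ∈ Finset.range (m + 1), a j ^ 2 := ⟨_, rfl⟩
  have hS0 : 0 < S := by
    have h1 : 0 < a 1 := by
      rw [ha]
      refine Real.sin_pos_of_pos_of_lt_pi (by simpa using hα0) ?_
      rw [Nat.cast_one, one_mul, hα, div_lt_iff₀ (by positivity)]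
      nlinarith [Real.pi_pos]
    have h2 : a 1 ^ 2 ≤ ∑ j ∈ Finset.range (m + 1), a j ^ 2 :=
      Finset.single_le_sum (f := fun j => a j ^ 2) (fun j _ => sq_nonneg _)
        (by simp; omega)
    have := Real.pi_pos
    have : 0 < ∑ j ∈ Finset.range (m + 1), a j ^ 2 := lt_of_lt_of_le (by positivity) h2
    rw [hS]
    positivity
  have hcont : Continuous fun φ => g (Real.cos φ) := by
    have h : ContinuousOn g (Set.Icc (-1) 1) := by
      have : LipschitzOnWith L.toNNReal g (Set.Icc (-1) 1) :=
        LipschitzOnWith.of_dist_le_mul fun x hx y hy => by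
          simpa [Real.dist_eq, hL] using hg x hx y hy
      exact this.continuousOn
    exact h.comp_continuous Real.continuous_cos fun φ => Real.cos_mem_Icc φ
  have hK := continuous_squareKernel a (m + 1)
  obtain ⟨p, hp, hpe⟩ := exists_polynomial_integral_squareKernel a m _ hcont (by simp)
  have hint0 := integral_squareKernel a (m + 1)
  have hint1 := fun θ => integral_cos_mul_squareKernel a (m + 1) (Real.cos α) θ (by simp [ha])
    (by
      simp only [ha, hα]
      push_cast
      rw [mul_div_cancel₀ _ (by positivity), Real.sin_pi])
    (fun j => by
      simp only [ha]
      push_cast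
      rw [show (j : ℝ) * α = (j + 1) * α - α by ring,
        show ((j : ℝ) + 2) * α = (j + 1) * α + α by ring, Real.sin_sub, Real.sin_add]
      ring)
  refine ⟨C S⁻¹ * p, (natDegree_C_mul_le _ _).trans hp, fun x hx => ?_⟩
  obtain ⟨θ, rfl⟩ : ∃ θ, Real.cos θ = x := ⟨Real.arccos x, Real.cos_arccos hx.1 hx.2⟩
  have hdist : ∀ φ, |Real.cos θ - Real.cos φ| ≤ (α + (2 - 2 * Real.cos (θ - φ)) / α) / 2 := by
    intro φ
    have h1 : (Real.cos θ - Real.cos φ) ^ 2 ≤ 2 - 2 * Real.cos (θ - φ) := by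
      rw [Real.cos_sub]
      nlinarith [sq_nonneg (Real.sin θ - Real.sin φ), Real.sin_sq_add_cos_sq θ,
        Real.sin_sq_add_cos_sq φ]
    rw [le_div_iff₀ two_pos, ← sub_le_iff_le_add', le_div_iff₀ hα0]
    nlinarith [sq_nonneg (|Real.cos θ - Real.cos φ| - α), sq_abs (Real.cos θ - Real.cos φ)]
  have hdiff : S * g (Real.cos θ) - p.eval (Real.cos θ) =
      ∫ φ in -Real.pi..Real.pi,
        (g (Real.cos θ) - g (Real.cos φ)) * squareKernel a (m + 1) (θ - φ) := by
    have hker : Continuous fun φ => squareKernel a (m + 1) (θ - φ) := by fun_prop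
    simp_rw [sub_mul]
    rw [hpe, hS, ← hint0 θ, mul_comm, ← intervalIntegral.integral_const_mul]
    exact (intervalIntegral.integral_sub ((hker.const_mul _).intervalIntegrable _ _)
      ((hcont.mul hker).intervalIntegrable _ _)).symm
  have hbound : |S * g (Real.cos θ) - p.eval (Real.cos θ)| ≤
      ∫ φ in -Real.pi..Real.pi, L * ((α / 2 + 1 / α) * squareKernel a (m + 1) (θ - φ) -
        1 / α * (Real.cos (θ - φ) * squareKernel a (m + 1) (θ - φ))) := by
    rw [hdiff, ← Real.norm_eq_abs]
    refine intervalIntegral.norm_integral_le_of_norm_le (by linarith [Real.pi_pos])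
      (Filter.Eventually.of_forall fun φ _ => ?_)
      (Continuous.intervalIntegrable (by fun_prop) _ _)
    rw [Real.norm_eq_abs, abs_mul, abs_of_nonneg (squareKernel_nonneg _ _ _)]
    refine (mul_le_mul_of_nonneg_right ((hg _ (Real.cos_mem_Icc _) _ (Real.cos_mem_Icc _)).trans
      (mul_le_mul_of_nonneg_left (hdist φ) hL)) (squareKernel_nonneg _ _ _)).trans_eq ?_
    field_simp
    ring
  rw [intervalIntegral.integral_const_mul, intervalIntegral.integral_sub
    (Continuous.intervalIntegrable (by fun_prop) _ _)
    (Continuous.intervalIntegrable (by fun_prop) _ _), intervalIntegral.integral_const_mul,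
    intervalIntegral.integral_const_mul, hint0, hint1, ← hS] at hbound
  have hcos : 1 / α * (1 - Real.cos α) ≤ α / 2 := by
    rw [one_div, inv_mul_le_iff₀ hα0]
    nlinarith [Real.one_sub_sq_div_two_le_cos (x := α)]
  have hfinal : |S * g (Real.cos θ) - p.eval (Real.cos θ)| ≤ S * (L * α) := by
    refine hbound.trans ?_
    have := mul_le_mul_of_nonneg_left hcos (mul_nonneg hL hS0.le)
    linarith
  have hαm : α ≤ Real.pi / m := by
    rw [hα]
    gcongr
    linarith
  calc |g (Real.cos θ) - (C S⁻¹ * p).eval (Real.cos θ)|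
      = S⁻¹ * |S * g (Real.cos θ) - p.eval (Real.cos θ)| := by
        rw [← abs_of_pos (inv_pos.2 hS0), ← abs_mul, abs_of_pos (inv_pos.2 hS0), eval_mul, eval_C,
          mul_sub, inv_mul_cancel_left₀ hS0.ne']
    _ ≤ S⁻¹ * (S * (L * α)) := by gcongr
    _ = L * α := inv_mul_cancel_left₀ hS0.ne' _
    _ ≤ L * (Real.pi / m) := by gcongr

open Polynomial in
/-- Jackson's inequality on an arbitrary compact interval. -/
lemma exists_polynomial_near_of_lipschitz (a b : ℝ) (hab : a < b) (m : ℕ) (hm : 1 ≤ m) (L : ℝ)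
    (hL : 0 ≤ L) (f : ℝ → ℝ)
    (hf : ∀ x ∈ Set.Icc a b, ∀ y ∈ Set.Icc a b, |f x - f y| ≤ L * |x - y|) :
    ∃ p : ℝ[X], p.natDegree ≤ m ∧
      ∀ x ∈ Set.Icc a b, |f x - p.eval x| ≤ L * (Real.pi * ((b - a) / 2) / m) := by
  obtain ⟨h, hh⟩ : ∃ h, h = (b - a) / 2 := ⟨_, rfl⟩
  have hh0 : 0 < h := by linarith
  have hmem : ∀ t ∈ Set.Icc (-1 : ℝ) 1, (a + b) / 2 + h * t ∈ Set.Icc a b := by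
    rintro t ⟨h1, h2⟩
    constructor <;> nlinarith
  obtain ⟨p, hp, hpe⟩ := exists_polynomial_near_of_lipschitz_unit m hm (L * h) (by positivity)
    (fun t => f ((a + b) / 2 + h * t)) (fun x hx y hy => by
      refine (hf _ (hmem x hx) _ (hmem y hy)).trans_eq ?_
      rw [show (a + b) / 2 + h * x - ((a + b) / 2 + h * y) = h * (x - y) by ring, abs_mul,
        abs_of_pos hh0, mul_assoc])
  refine ⟨p.comp (C h⁻¹ * (X - C ((a + b) / 2))), ?_, fun x hx => ?_⟩
  · rw [natDegree_comp, natDegree_C_mul (inv_ne_zero hh0.ne'), natDegree_X_sub_C, mul_one]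
    exact hp
  · have ht : h⁻¹ * (x - (a + b) / 2) ∈ Set.Icc (-1 : ℝ) 1 := by
      obtain ⟨h1, h2⟩ := hx
      rw [inv_mul_eq_div]
      constructor
      · rw [le_div_iff₀ hh0]; linarith
      · rw [div_le_iff₀ hh0]; linarith
    have := hpe _ ht
    rw [mul_inv_cancel_left₀ hh0.ne', add_sub_cancel] at this
    simp only [eval_comp, eval_mul, eval_C, eval_sub, eval_X]
    refine this.trans_eq ?_
    rw [← hh]
    ring

open Polynomial in
lemma exists_derivative_eq (p : ℝ[X]) (m : ℕ) (hp : p.natDegree ≤ m) :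
    ∃ P : ℝ[X], P.natDegree ≤ m + 1 ∧ derivative P = p := by
  refine ⟨∑ i ∈ Finset.range (m + 1), monomial (i + 1) (p.coeff i / (i + 1)), ?_, ?_⟩
  · refine natDegree_sum_le_of_forall_le _ _ fun i hi => (natDegree_monomial_le _).trans ?_
    simp at hi
    omega
  · conv_rhs => rw [p.as_sum_range' (m + 1) (by omega)]
    rw [derivative_sum]
    refine Finset.sum_congr rfl fun i _ => ?_
    rw [derivative_monomial, Nat.add_sub_cancel, Nat.cast_add_one,
      div_mul_cancel₀ _ (by positivity)]

open Polynomial in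
/-- Iterated Jackson inequality for a chain `F 0, F 1, …` of successive derivatives. -/
lemma exists_polynomial_near_of_iterated_deriv (a b : ℝ) (hab : a < b) (n : ℕ) :
    ∀ (m : ℕ), n ≤ m → ∀ (F : ℕ → ℝ → ℝ) (M : ℝ),
      (∀ i, ∀ x ∈ Set.Icc a b, HasDerivWithinAt (F i) (F (i + 1) x) (Set.Icc a b) x) →
      (∀ x ∈ Set.Icc a b, |F n x| ≤ M) →
      ∃ p : ℝ[X], p.natDegree ≤ m ∧ ∀ x ∈ Set.Icc a b,
        |F 0 x - p.eval x| ≤ M * ((Real.pi * ((b - a) / 2)) ^ n / m.descFactorial n) := by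
  induction n with
  | zero =>
    intro m _ F M _ hM
    exact ⟨0, by simp, fun x hx => by simpa using hM x hx⟩
  | succ n ih =>
    intro m hm F M hF hM
    obtain ⟨m, rfl⟩ : ∃ k, m = k + 1 := ⟨m - 1, by omega⟩
    obtain ⟨p, hp, hpe⟩ := ih m (by omega) (fun i => F (i + 1)) M (fun i => hF (i + 1)) hM
    obtain ⟨P, hP, hPp⟩ := exists_derivative_eq p m hp
    set ε := M * ((Real.pi * ((b - a) / 2)) ^ n / m.descFactorial n)
    have hε : 0 ≤ ε := (abs_nonneg _).trans (hpe a ⟨le_rfl, hab.le⟩)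
    obtain ⟨q, hq, hqe⟩ := exists_polynomial_near_of_lipschitz a b hab (m + 1) (by omega) ε hε
      (fun x => F 0 x - P.eval x) (fun x hx y hy => by
        simpa using (convex_Icc a b).norm_image_sub_le_of_norm_hasDerivWithin_le
          (f := fun x => F 0 x - P.eval x) (f' := fun x => F 1 x - p.eval x)
          (fun x hx => (hF 0 x hx).sub (hPp ▸ (P.hasDerivAt x).hasDerivWithinAt)) hpe hy hx)
    refine ⟨P + q, (natDegree_add_le _ _).trans (max_le hP hq), fun x hx => ?_⟩
    rw [eval_add, ← sub_sub]
    refine (hqe x hx).trans_eq ?_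
    simp only [ε]
    rw [Nat.succ_descFactorial_succ]
    push_cast
    rw [pow_succ]
    field_simp

lemma factorial_le_two_mul_half_pow (n : ℕ) : (n.factorial : ℝ) ≤ 2 * (n / 2 : ℝ) ^ n := by
  induction n with
  | zero => simp
  | succ n ih =>
    rcases Nat.eq_zero_or_pos n with rfl | hn
    · norm_num
    have hn' : (0 : ℝ) < n := by exact_mod_cast hn
    have hbern : (2 : ℝ) ≤ (1 + 1 / n) ^ n := by
      have := one_add_mul_le_pow (a := (1 / n : ℝ))
        (by linarith [show 0 < (1 / n : ℝ) by positivity]) n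
      rw [mul_one_div_cancel hn'.ne'] at this
      linarith
    have hpow : 2 * (n / 2 : ℝ) ^ n ≤ ((n + 1) / 2 : ℝ) ^ n := by
      rw [show ((n + 1) / 2 : ℝ) = (1 + 1 / n) * (n / 2) by field_simp, mul_pow]
      gcongr
    rw [Nat.factorial_succ]
    push_cast
    calc ((n : ℝ) + 1) * n.factorial ≤ (n + 1) * ((n + 1) / 2 : ℝ) ^ n := by
          gcongr; exact ih.trans hpow
      _ = 2 * ((n + 1) / 2 : ℝ) ^ (n + 1) := by ring

lemma factorial_rpow_div_descFactorial_le (δ : ℝ) (hδ : 1 ≤ δ) (m n : ℕ) (hm : 1 ≤ m)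
    (hn : 3 * n ≤ m) :
    (n.factorial : ℝ) ^ δ / m.descFactorial n ≤ 2 * (3 / 4 * ((n : ℝ) ^ δ / m)) ^ n := by
  have hm0 : (0 : ℝ) < m := by exact_mod_cast hm
  have hnn : (0 : ℝ) < (n : ℝ) ^ n := by
    rcases n with _ | n
    · simp
    · positivity
  have hfac : (n.factorial : ℝ) ^ δ ≤ 2 * ((n : ℝ) ^ δ / 2) ^ n := by
    have h1 : (n.factorial : ℝ) ^ (δ - 1) ≤ ((n : ℝ) ^ n) ^ (δ - 1) :=
      Real.rpow_le_rpow (by positivity) (by exact_mod_cast n.factorial_le_pow) (by linarith)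
    calc (n.factorial : ℝ) ^ δ = (n.factorial : ℝ) ^ (δ - 1) * n.factorial := by
          rw [Real.rpow_sub_one (by positivity), div_mul_cancel₀ _ (by positivity)]
      _ ≤ ((n : ℝ) ^ n) ^ (δ - 1) * (2 * (n / 2 : ℝ) ^ n) := by
          gcongr
          exact factorial_le_two_mul_half_pow n
      _ = 2 * (((n : ℝ) ^ n) ^ δ / 2 ^ n) := by
          rw [Real.rpow_sub_one hnn.ne', div_pow]
          field_simp
      _ = 2 * ((n : ℝ) ^ δ / 2) ^ n := by
          rw [div_pow, ← Real.rpow_natCast, ← Real.rpow_natCast (_ ^ δ),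
            ← Real.rpow_mul (by positivity), ← Real.rpow_mul (by positivity), mul_comm δ]
  have hdesc : (2 * m / 3 : ℝ) ^ n ≤ m.descFactorial n := by
    have hpow : (((m + 1 - n : ℕ) : ℝ)) ^ n ≤ m.descFactorial n := by
      exact_mod_cast Nat.pow_sub_le_descFactorial m n
    refine le_trans (pow_le_pow_left₀ (by positivity) ?_ n) hpow
    rw [Nat.cast_sub (by omega)]
    have : (3 * n : ℝ) ≤ m := by exact_mod_cast hn
    push_cast
    linarith
  calc (n.factorial : ℝ) ^ δ / m.descFactorial n
      ≤ 2 * ((n : ℝ) ^ δ / 2) ^ n / (2 * m / 3 : ℝ) ^ n := by gcongr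
    _ = 2 * (3 / 4 * ((n : ℝ) ^ δ / m)) ^ n := by
      rw [mul_div_assoc, ← div_pow]
      congr 2
      field_simp
      norm_num

open Polynomial in
lemma GevreyOn.exists_polynomial_near {a b δ CG A : ℝ} {f : ℝ → ℝ} (hf : GevreyOn a b δ CG A f)
    (hab : a < b) (hδ : 1 ≤ δ) (hCG : 0 < CG) (hA : 0 < A) (m n : ℕ) (hm : 1 ≤ m)
    (hn : 3 * n ≤ m) :
    ∃ p : ℝ[X], p.natDegree ≤ m ∧ ∀ x ∈ Set.Icc a b, |f x - p.eval x| ≤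
      CG * (2 * (Real.exp 1 * (A * (b - a) / 2) * ((n : ℝ) ^ δ / m)) ^ n) := by
  obtain ⟨⟨U, hU, habU, hfU⟩, hbound⟩ := hf
  have hderiv : ∀ i, ∀ x ∈ Set.Icc a b, HasDerivWithinAt (iteratedDeriv i f)
      (iteratedDeriv (i + 1) f x) (Set.Icc a b) x := by
    intro i x hx
    have h1 : DifferentiableAt ℝ (iteratedDeriv i f) x :=
      ((hfU.differentiableOn_iteratedDerivWithin (m := i)
        (by exact_mod_cast WithTop.coe_lt_top (i : ℕ)) hU.uniqueDiffOn).congr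
        fun y hy => (iteratedDerivWithin_of_isOpen hU hy).symm).differentiableAt
        (hU.mem_nhds (habU hx))
    rw [iteratedDeriv_succ]
    exact h1.hasDerivAt.hasDerivWithinAt
  obtain ⟨p, hp, hpe⟩ := exists_polynomial_near_of_iterated_deriv a b hab n m (by omega)
    (fun i => iteratedDeriv i f) _ hderiv (hbound n)
  refine ⟨p, hp, fun x hx => ?_⟩
  have hB : 0 < b - a := by linarith
  have hx' := hpe x hx
  rw [iteratedDeriv_zero] at hx'
  calc |f x - p.eval x| ≤ _ := hx'
    _ = CG * ((Real.pi * (A * (b - a) / 2)) ^ n *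
        ((n.factorial : ℝ) ^ δ / m.descFactorial n)) := by
      rw [show Real.pi * (A * (b - a) / 2) = A * (Real.pi * ((b - a) / 2)) by ring,
        mul_pow A]
      ring
    _ ≤ CG * ((Real.pi * (A * (b - a) / 2)) ^ n *
        (2 * (3 / 4 * ((n : ℝ) ^ δ / m)) ^ n)) := by
      gcongr
      exact factorial_rpow_div_descFactorial_le δ hδ m n hm hn
    _ = CG * (2 * (Real.pi * (3 / 4) * (A * (b - a) / 2) * ((n : ℝ) ^ δ / m)) ^ n) := by
      rw [mul_left_comm (_ ^ n), ← mul_pow]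
      ring
    _ ≤ _ := by
      gcongr
      linarith [Real.pi_lt_d2, Real.exp_one_gt_d9]

lemma rho_eq_exp_arsinh (r : ℝ) : rho r = Real.exp (Real.arsinh r) := by
  rw [Real.exp_arsinh, rho]

lemma rho_pos (r : ℝ) : 0 < rho r := rho_eq_exp_arsinh r ▸ Real.exp_pos _

lemma rho_le_exp (r : ℝ) (hr : 0 ≤ r) : rho r ≤ Real.exp r := by
  rw [rho_eq_exp_arsinh, Real.exp_le_exp, ← Real.sinh_le_sinh, Real.sinh_arsinh]
  exact Real.self_le_sinh_iff.2 hr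

lemma rho_one_div_le (B : ℝ) (hB : 0 < B) (hB1 : B ≤ 1) : rho (1 / B) ≤ Real.exp 1 / B := by
  have h : √(1 + (1 / B) ^ 2) ≤ 1.5 / B := by
    rw [Real.sqrt_le_left (by positivity), div_pow, div_pow, ← sub_nonneg]
    have : (1.5 ^ 2 / B ^ 2 - (1 + 1 ^ 2 / B ^ 2)) = (1.25 - B ^ 2) / B ^ 2 := by
      field_simp
      ring
    rw [this]
    exact div_nonneg (by nlinarith) (by positivity)
  calc rho (1 / B) ≤ 1 / B + 1.5 / B := by unfold rho; gcongr
    _ = 2.5 / B := by ring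
    _ ≤ Real.exp 1 / B := by
      gcongr
      linarith [Real.exp_one_gt_d9]

lemma seven_lt_exp_two : (7 : ℝ) < Real.exp 2 := by
  rw [show (2 : ℝ) = 1 + 1 by norm_num, Real.exp_add]
  nlinarith [Real.exp_one_gt_d9]

lemma exists_order_of_le_one (B δ : ℝ) (hB : 0 < B) (hB1 : B ≤ 1) (hδ : 1 ≤ δ) (m : ℕ)
    (hm : 3 ≤ m) :
    ∃ n : ℕ, 3 * n ≤ m ∧ 2 * (Real.exp 1 * B * ((n : ℝ) ^ δ / m)) ^ n ≤
      2 * Real.exp (2 * δ + 2) * rho (1 / B) ^ (-(m : ℝ) ^ (1 / δ) / Real.exp 2) := by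
  have hm0 : (3 : ℝ) ≤ m := by exact_mod_cast hm
  have hδ0 : 0 < δ := by linarith
  obtain ⟨E, hE⟩ : ∃ E, E = (m : ℝ) ^ (1 / δ) / Real.exp 2 := ⟨_, rfl⟩
  have hE0 : 0 < E := hE ▸ by positivity
  have hexp1 := Real.add_one_lt_exp (one_ne_zero (α := ℝ))
  have hq0 : 0 < B / Real.exp 1 := by positivity
  have hq1 : B / Real.exp 1 ≤ 1 := by rw [div_le_one (by positivity)]; linarith
  have hrho : (B / Real.exp 1) ^ E ≤ rho (1 / B) ^ (-(m : ℝ) ^ (1 / δ) / Real.exp 2) := by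
    rw [neg_div, ← hE, ← inv_div, Real.inv_rpow (by positivity),
      ← Real.rpow_neg (by positivity)]
    exact Real.rpow_le_rpow_of_nonpos (rho_pos _) (rho_one_div_le B hB hB1) (by linarith)
  rcases lt_or_ge E 1 with h | h
  · refine ⟨1, by omega, ?_⟩
    calc 2 * (Real.exp 1 * B * (((1 : ℕ) : ℝ) ^ δ / m)) ^ 1 ≤ 2 * (Real.exp 1 * B * 1) := by
          rw [pow_one, Nat.cast_one, Real.one_rpow]
          gcongr
          rw [div_le_one (by linarith)]
          linarith
      _ = 2 * Real.exp 2 * (B / Real.exp 1) := by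
          rw [show (2 : ℝ) = 1 + 1 by norm_num, Real.exp_add]
          field_simp
      _ ≤ 2 * Real.exp (2 * δ + 2) * (B / Real.exp 1) ^ E := by
          gcongr
          · linarith
          · simpa using Real.rpow_le_rpow_of_exponent_ge hq0 hq1 h.le
      _ ≤ _ := by gcongr
  · have hn : (⌈E⌉₊ : ℝ) < E + 1 := Nat.ceil_lt_add_one hE0.le
    have hn' : E ≤ ⌈E⌉₊ := Nat.le_ceil E
    refine ⟨⌈E⌉₊, ?_, ?_⟩
    · have h1 : E ≤ m / 7 := by
        rw [hE]
        gcongr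
        · calc (m : ℝ) ^ (1 / δ) ≤ (m : ℝ) ^ (1 : ℝ) :=
              Real.rpow_le_rpow_of_exponent_le (by linarith) (by rw [div_le_one hδ0]; exact hδ)
            _ = m := Real.rpow_one _
        · exact seven_lt_exp_two.le
      have : 3 * (⌈E⌉₊ : ℝ) ≤ m := by linarith
      exact_mod_cast this
    · generalize ⌈E⌉₊ = n at hn hn'
      have hpow : (n : ℝ) ^ δ / m ≤ Real.exp (δ / E - 2) := by
        have hmE : (m : ℝ) = (E * Real.exp 2) ^ δ := by
          rw [hE, div_mul_cancel₀ _ (by positivity), ← Real.rpow_mul (by positivity),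
            one_div_mul_cancel hδ0.ne', Real.rpow_one]
        rw [hmE, ← Real.div_rpow (by positivity) (by positivity)]
        have h1 : (n : ℝ) / (E * Real.exp 2) ≤ Real.exp (1 / E - 2) := by
          rw [← div_div, div_le_iff₀ (by positivity), ← Real.exp_add, sub_add_cancel]
          refine le_trans ?_ (Real.add_one_le_exp (1 / E))
          rw [div_add_one hE0.ne']
          gcongr
          linarith
        calc _ ≤ (Real.exp (1 / E - 2)) ^ δ := by gcongr
          _ = Real.exp (δ / E - 2 * δ) := by
            rw [← Real.exp_mul]
            ring_nf
          _ ≤ _ := Real.exp_le_exp.2 (by linarith)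
      calc 2 * (Real.exp 1 * B * ((n : ℝ) ^ δ / m)) ^ n
          ≤ 2 * (Real.exp 1 * B * Real.exp (δ / E - 2)) ^ n := by gcongr
        _ = 2 * (Real.exp (n * (δ / E)) * (B / Real.exp 1) ^ n) := by
          rw [Real.exp_nat_mul, ← mul_pow]
          congr 2
          rw [Real.exp_sub, show (2 : ℝ) = 1 + 1 by norm_num, Real.exp_add]
          field_simp
        _ ≤ 2 * (Real.exp (2 * δ + 2) * (B / Real.exp 1) ^ E) := by
          gcongr
          · have : n / E ≤ 2 := by
              rw [div_le_iff₀ hE0]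
              linarith
            calc n * (δ / E) = n / E * δ := by ring
              _ ≤ 2 * δ := by gcongr
              _ ≤ 2 * δ + 2 := by linarith
          · rw [← Real.rpow_natCast]
            exact Real.rpow_le_rpow_of_exponent_ge hq0 hq1 hn'
        _ ≤ _ := by
          rw [← mul_assoc]
          gcongr

lemma exists_order_of_one_le (B δ : ℝ) (hB1 : 1 ≤ B) (hδ : 1 ≤ δ) (m : ℕ) (hm : 3 ≤ m) :
    ∃ n : ℕ, 3 * n ≤ m ∧ 2 * (Real.exp 1 * B * ((n : ℝ) ^ δ / m)) ^ n ≤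
      2 * Real.exp (2 * δ + 2) * rho (1 / B) ^ (-(m : ℝ) ^ (1 / δ) / Real.exp 2) := by
  have hm0 : (3 : ℝ) ≤ m := by exact_mod_cast hm
  have hδ0 : 0 < δ := by linarith
  have hδ1 : 1 / δ ≤ 1 := by rw [div_le_one hδ0]; exact hδ
  have h7 := seven_lt_exp_two
  have hB0 : 0 < B := by linarith
  have hc : 7 ≤ Real.exp 2 * B := by nlinarith
  obtain ⟨y, hy⟩ : ∃ y, y = (m / (Real.exp 2 * B)) ^ (1 / δ) := ⟨_, rfl⟩
  have hy0 : 0 ≤ y := hy ▸ by positivity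
  have hn : (⌊y⌋₊ : ℝ) ≤ y := Nat.floor_le hy0
  have hn' : y < ⌊y⌋₊ + 1 := Nat.lt_floor_add_one y
  refine ⟨⌊y⌋₊, ?_, ?_⟩
  · rcases lt_or_ge (m / (Real.exp 2 * B)) 1 with h | h
    · have : y < 1 := hy ▸ Real.rpow_lt_one (by positivity) h (by positivity)
      rw [Nat.floor_eq_zero.2 this]
      omega
    · have h1 : y ≤ m / (Real.exp 2 * B) := by
        rw [hy]
        exact (Real.rpow_le_rpow_of_exponent_le h hδ1).trans_eq (Real.rpow_one _)
      have h2 : m / (Real.exp 2 * B) ≤ m / 7 := by gcongr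
      have : 3 * (⌊y⌋₊ : ℝ) ≤ m := by linarith
      exact_mod_cast this
  · generalize ⌊y⌋₊ = n at hn hn'
    have hpow : (n : ℝ) ^ δ / m ≤ 1 / (Real.exp 2 * B) := by
      rw [div_le_iff₀ (by linarith), one_div_mul_eq_div]
      calc (n : ℝ) ^ δ ≤ y ^ δ := by gcongr
        _ = _ := by
          rw [hy, ← Real.rpow_mul (by positivity), one_div_mul_cancel hδ0.ne', Real.rpow_one]
    have hyE : (m : ℝ) ^ (1 / δ) / Real.exp 2 / B ≤ y := by
      rw [hy, Real.div_rpow (by positivity) (by positivity), div_div]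
      gcongr
      exact (Real.rpow_le_rpow_of_exponent_le (by linarith) hδ1).trans_eq (Real.rpow_one _)
    have hrho : Real.exp (-y) ≤ rho (1 / B) ^ (-(m : ℝ) ^ (1 / δ) / Real.exp 2) := by
      refine le_trans ?_ (Real.rpow_le_rpow_of_nonpos (rho_pos _) (rho_le_exp (1 / B)
        (by positivity)) ?_)
      · rw [← Real.exp_mul, Real.exp_le_exp, neg_div]
        rw [div_eq_mul_one_div _ B] at hyE
        linarith
      · rw [neg_div]
        exact neg_nonpos.2 (by positivity)
    calc 2 * (Real.exp 1 * B * ((n : ℝ) ^ δ / m)) ^ n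
        ≤ 2 * (Real.exp 1 * B * (1 / (Real.exp 2 * B))) ^ n := by gcongr
      _ = 2 * Real.exp (-n) := by
        have : Real.exp 1 * B * (1 / (Real.exp 2 * B)) = Real.exp (-1) := by
          rw [show (-1 : ℝ) = 1 - 2 by norm_num, Real.exp_sub]
          field_simp
        rw [this, ← Real.exp_nat_mul, mul_neg_one]
      _ ≤ 2 * Real.exp (2 * δ + 2 + -y) := by
        gcongr
        linarith
      _ = 2 * Real.exp (2 * δ + 2) * Real.exp (-y) := by rw [Real.exp_add]; ring
      _ ≤ _ := by gcongr

open Polynomial in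
/-- Stability and exactness on `𝒫_m` reduce the interpolation error to the approximation error. -/
lemma abs_sub_lagInterp_le {a b : ℝ} {m : ℕ} {nodes : Fin (m + 1) → ℝ}
    (hinj : Function.Injective nodes) {Λ : ℝ}
    (hstab : ∀ f : ℝ → ℝ, ContinuousOn f (Set.Icc a b) →
      ∀ M : ℝ, (∀ x ∈ Set.Icc a b, |f x| ≤ M) →
        ∀ y ∈ Set.Icc a b, |(lagInterp nodes f).eval y| ≤ Λ * M)
    {f : ℝ → ℝ} (hf : ContinuousOn f (Set.Icc a b)) {p : ℝ[X]} (hp : p.natDegree ≤ m) {ε : ℝ}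
    (hε : ∀ x ∈ Set.Icc a b, |f x - p.eval x| ≤ ε) :
    ∀ y ∈ Set.Icc a b, |f y - (lagInterp nodes f).eval y| ≤ (Λ + 1) * ε := by
  intro y hy
  have hpI : p = lagInterp nodes fun x => p.eval x :=
    Lagrange.eq_interpolate hinj.injOn (degree_le_natDegree.trans_lt (by
      rw [Finset.card_univ, Fintype.card_fin]
      exact_mod_cast Nat.lt_succ_of_le hp))
  have hlin : lagInterp nodes (fun x => f x - p.eval x) = lagInterp nodes f - p := by
    conv_rhs => rw [hpI]
    unfold lagInterp
    rw [← map_sub]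
    rfl
  have h1 := hstab (fun x => f x - p.eval x) (hf.sub p.continuousOn) ε hε y hy
  rw [hlin, eval_sub] at h1
  have h2 := hε y hy
  calc |f y - (lagInterp nodes f).eval y|
      = |(f y - p.eval y) - ((lagInterp nodes f).eval y - p.eval y)| := by ring_nf
    _ ≤ _ := abs_sub _ _
    _ ≤ _ := by linarith

/-- There is `C : (0,∞)×[1,∞) → (0,∞)`, monotonically increasing in its first
argument, such that: for every interval `[a,b]`, every integer `m ≥ 3`, every
choice of `m+1` distinct nodes in `[a,b]` whose Lagrange interpolation operator
`𝓘_m^{[a,b]} : C([a,b]) → 𝒫_m` is stable with constant `Λ_m ≥ 1`, every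
`δ ≥ 1`, `C_G, A > 0` and every `f ∈ G^δ([a,b], C_G, A)`, one has, with
`B = A(b-a)/2`,
`‖f - 𝓘_m^{[a,b]} f‖_{C([a,b])} ≤ C(B,δ)·C_G·(Λ_m+1)·ρ(1/B)^{-m^{1/δ}/e²}`. -/
theorem stmt1 :
    ∃ C : ℝ → ℝ → ℝ,
      (∀ B δ : ℝ, 0 < B → 1 ≤ δ → 0 < C B δ) ∧
      (∀ B₁ B₂ δ : ℝ, 0 < B₁ → B₁ ≤ B₂ → 1 ≤ δ → C B₁ δ ≤ C B₂ δ) ∧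
      ∀ a b : ℝ, a < b →
        ∀ m : ℕ, 3 ≤ m →
          ∀ nodes : Fin (m + 1) → ℝ, Function.Injective nodes →
            (∀ j, nodes j ∈ Set.Icc a b) →
            ∀ Λ : ℝ, 1 ≤ Λ →
              (∀ f : ℝ → ℝ, ContinuousOn f (Set.Icc a b) →
                ∀ M : ℝ, (∀ x ∈ Set.Icc a b, |f x| ≤ M) →
                  ∀ y ∈ Set.Icc a b, |(lagInterp nodes f).eval y| ≤ Λ * M) →
              ∀ δ CG A : ℝ, 1 ≤ δ → 0 < CG → 0 < A →
                ∀ f : ℝ → ℝ, GevreyOn a b δ CG A f →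
                  ∀ y ∈ Set.Icc a b,
                    |f y - (lagInterp nodes f).eval y| ≤
                      C (A * (b - a) / 2) δ * CG * (Λ + 1) *
                        rho (1 / (A * (b - a) / 2)) ^
                          (-(m : ℝ) ^ (1 / δ) / Real.exp 2) := by
  refine ⟨fun _ δ => 2 * Real.exp (2 * δ + 2), fun _ _ _ _ => by positivity,
    fun _ _ _ _ _ _ => le_rfl, ?_⟩
  intro a b hab m hm nodes hinj hnodes Λ hΛ hstab δ CG A hδ hCG hA f hf
  have hB : 0 < A * (b - a) / 2 := by
    have : 0 < b - a := sub_pos.2 hab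
    positivity
  obtain ⟨n, hn, hle⟩ : ∃ n : ℕ, 3 * n ≤ m ∧
      2 * (Real.exp 1 * (A * (b - a) / 2) * ((n : ℝ) ^ δ / m)) ^ n ≤ 2 * Real.exp (2 * δ + 2) *
        rho (1 / (A * (b - a) / 2)) ^ (-(m : ℝ) ^ (1 / δ) / Real.exp 2) := by
    rcases le_total (A * (b - a) / 2) 1 with h | h
    · exact exists_order_of_le_one _ δ hB h hδ m hm
    · exact exists_order_of_one_le _ δ h hδ m hm
  obtain ⟨p, hp, hpe⟩ := hf.exists_polynomial_near hab hδ hCG hA m n (by omega) hn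
  have hcont : ContinuousOn f (Set.Icc a b) := by
    obtain ⟨⟨U, -, habU, hfU⟩, -⟩ := hf
    exact hfU.continuousOn.mono habU
  intro y hy
  refine (abs_sub_lagInterp_le hinj hstab hcont hp hpe y hy).trans ?_
  refine (mul_le_mul_of_nonneg_left (mul_le_mul_of_nonneg_left hle hCG.le)
    (by linarith)).trans_eq ?_
  ring
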